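/- Let m > 1 be a positive integer and α a nonzero integer. Define T_m(α) = Σ over m-tuples (ℓ₁,…,ℓ_m) of nonzero integers with ℓ₁+⋯+ℓ_m = α of 1/(|ℓ₁|⋯|ℓ_m|). Then T_m satisfies the recursion T_m(α) = (2m/α)·Σ_{j=0}^{α} T_{m-1}(j) − (m/α)·(T_{m-1}(0) + T_{m-1}(α)) for positive α, where T₁(α) = 1/|α| for α ≠ 0 and T₁(0) = 0. -/

import Mathlib

/-- `T m α` is the sum over `m`-tuples of nonzero integers summing to `α` of the
product of the reciprocals of their absolute values. -/
noncomputable def T (m : ℕ) (α : ℤ) : ℝ :=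
  ∑' ℓ : {f : Fin m → ℤ // (∀ i, f i ≠ 0) ∧ ∑ i, f i = α},
    ∏ i, (1 : ℝ) / |(ℓ.1 i : ℝ)|


open Filter Topology

noncomputable def wgt (r : ℝ) (k : ℤ) : ℝ := r ^ k.natAbs / |(k : ℝ)|

noncomputable def U (r : ℝ) (n : ℕ) (j : ℤ) : ℝ :=
  ∑' f : Fin n → ℤ, if ∑ i, f i = j then ∏ i, wgt r (f i) else 0

lemma wgt_nonneg {r : ℝ} (hr : 0 ≤ r) (k : ℤ) : 0 ≤ wgt r k := by
  unfold wgt; positivity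

lemma wgt_neg (r : ℝ) (k : ℤ) : wgt r (-k) = wgt r k := by
  simp [wgt]

lemma hasSum_wgt {r : ℝ} (hr : 0 ≤ r) (hr1 : r < 1) :
    HasSum (wgt r) (-2 * Real.log (1 - r)) := by
  have h := Real.hasSum_pow_div_log_of_abs_lt_one (x := r) (by rw [abs_of_nonneg hr]; exact hr1)
  have e : ∀ n : ℕ, wgt r ((n : ℤ) + 1) = r ^ (n + 1) / ((n : ℝ) + 1) := by
    intro n
    have h1 : ((n : ℤ) + 1).natAbs = n + 1 := by omega
    have h2 : |(n : ℝ) + 1| = n + 1 := abs_of_nonneg (by positivity)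
    simp [wgt, h1, h2]
  have h1 : HasSum (fun n : ℕ => wgt r ((n : ℤ) + 1)) (-Real.log (1 - r)) := by
    simpa only [e] using h
  have h2 : HasSum (fun n : ℕ => wgt r (-((n : ℤ) + 1))) (-Real.log (1 - r)) := by
    simpa only [wgt_neg] using h1
  have := h1.of_add_one_of_neg_add_one h2
  convert this using 1
  simp [wgt]; ring

lemma hasSum_pi {g : ℤ → ℝ} (hg : ∀ k, 0 ≤ g k) {s : ℝ} (hs : HasSum g s) (n : ℕ) :
    HasSum (fun f : Fin n → ℤ => ∏ i, g (f i)) (s ^ n) := by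
  induction n with
  | zero => simpa only [Finset.univ_eq_empty, Finset.prod_empty, pow_zero] using
      hasSum_unique (fun _ : Fin 0 → ℤ => (1 : ℝ))
  | succ n ih =>
    have hP : (0 : (Fin n → ℤ) → ℝ) ≤ fun f : Fin n → ℤ => ∏ i, g (f i) :=
      fun f => Finset.prod_nonneg fun i _ => hg (f i)
    have hS := Summable.mul_of_nonneg hs.summable ih.summable hg hP
    have h := hs.mul ih hS
    rw [← (Fin.insertNthEquiv (fun _ => ℤ) (0 : Fin (n + 1))).hasSum_iff, pow_succ']
    have e : (fun f : Fin (n + 1) → ℤ => ∏ i, g (f i)) ∘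
        (Fin.insertNthEquiv (fun _ => ℤ) (0 : Fin (n + 1))) =
        fun x : ℤ × (Fin n → ℤ) => g x.1 * ∏ i, g (x.2 i) := by
      funext x
      simp [Fin.prod_univ_succ]
    rw [e]
    exact h

lemma prod_bound (p : ℕ) (f : Fin (p + 1) → ℤ) :
    ∏ i, wgt 1 (f i) ≤ ∑ i : Fin (p + 1), ∏ j : Fin p,
      (|(f (i.succAbove j) : ℝ)| ^ (1 + 1 / (p : ℝ)))⁻¹ := by
  have hnn : ∀ i ∈ Finset.univ, 0 ≤ ∏ j : Fin p,
      (|(f ((i : Fin (p + 1)).succAbove j) : ℝ)| ^ (1 + 1 / (p : ℝ)))⁻¹ := by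
    intro i _
    exact Finset.prod_nonneg fun j _ => by positivity
  by_cases h0 : ∃ i, f i = 0
  · obtain ⟨i, hi⟩ := h0
    rw [Finset.prod_eq_zero (Finset.mem_univ i) (by simp [wgt, hi])]
    exact Finset.sum_nonneg hnn
  push Not at h0
  obtain ⟨i, hi⟩ := Finite.exists_max (fun i => |(f i : ℝ)|)
  refine le_trans ?_ (Finset.single_le_sum hnn (Finset.mem_univ i))
  rw [Fin.prod_univ_succAbove _ i]
  have hpos : ∀ i, 0 < |(f i : ℝ)| := fun i => by simpa using h0 i
  have h1 : ∀ i, 1 ≤ |(f i : ℝ)| := fun i => by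
    have := Int.one_le_abs (h0 i)
    exact_mod_cast this
  have key : wgt 1 (f i) ≤ ∏ j : Fin p, (|(f (i.succAbove j) : ℝ)| ^ (1 / (p : ℝ)))⁻¹ := by
    rw [Finset.prod_inv_distrib]
    simp only [wgt, one_pow, one_div (|(f i : ℝ)|)]
    apply inv_anti₀
    · exact Finset.prod_pos fun j _ => Real.rpow_pos_of_pos (hpos _) _
    · calc ∏ j : Fin p, |(f (i.succAbove j) : ℝ)| ^ (1 / (p : ℝ))
          ≤ ∏ j : Fin p, |(f i : ℝ)| ^ (1 / (p : ℝ)) := by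
            apply Finset.prod_le_prod
            · intro j _; positivity
            · intro j _; exact Real.rpow_le_rpow (abs_nonneg _) (hi _) (by positivity)
        _ = (|(f i : ℝ)| ^ (1 / (p : ℝ))) ^ p := by simp
        _ ≤ |(f i : ℝ)| := by
            rcases Nat.eq_zero_or_pos p with rfl | hp
            · simpa using h1 i
            · rw [← Real.rpow_natCast, ← Real.rpow_mul (abs_nonneg _)]
              have : (1 / (p : ℝ)) * p = 1 := by field_simp
              rw [this, Real.rpow_one]
  calc wgt 1 (f i) * ∏ j, wgt 1 (f (i.succAbove j))
      ≤ (∏ j : Fin p, (|(f (i.succAbove j) : ℝ)| ^ (1 / (p : ℝ)))⁻¹) *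
        ∏ j, wgt 1 (f (i.succAbove j)) := by
        apply mul_le_mul_of_nonneg_right key
        exact Finset.prod_nonneg fun j _ => wgt_nonneg zero_le_one _
    _ = _ := by
        rw [← Finset.prod_mul_distrib]
        refine Finset.prod_congr rfl fun j _ => ?_
        rw [Real.rpow_add (hpos _), Real.rpow_one, mul_inv, mul_comm]
        simp [wgt]

lemma summable_rpow_int {s : ℝ} (hs : 1 < s) : Summable (fun k : ℤ => (|(k : ℝ)| ^ s)⁻¹) := by
  have h := Real.summable_abs_int_rpow hs
  refine h.congr fun k => ?_
  rw [Real.rpow_neg (abs_nonneg _)]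

lemma summable_fiber (p : ℕ) (j : ℤ) :
    Summable (fun f : Fin (p + 1) → ℤ => if ∑ i, f i = j then ∏ i, wgt 1 (f i) else 0) := by
  set v : ℤ → ℝ := fun k => (|(k : ℝ)| ^ (1 + 1 / (p : ℝ)))⁻¹ with hv
  have hpi : Summable (fun g : Fin p → ℤ => ∏ i, v (g i)) := by
    rcases Nat.eq_zero_or_pos p with rfl | hp
    · exact (hasSum_unique _).summable
    · exact (hasSum_pi (g := v) (fun k => by rw [hv]; positivity)
        (summable_rpow_int (lt_add_of_pos_right _ (by positivity))).hasSum p).summable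
  have hi : ∀ i : Fin (p + 1), Summable (fun f : {f : Fin (p + 1) → ℤ | ∑ i, f i = j} =>
      ∏ k, v (f.1 (i.succAbove k))) := by
    intro i
    refine hpi.comp_injective
      (i := fun f : {f : Fin (p + 1) → ℤ | ∑ i, f i = j} => fun k => f.1 (i.succAbove k)) ?_
    rintro ⟨f, hf⟩ ⟨g, hg⟩ hfg
    simp only [Set.mem_ofPred_eq] at hf hg
    have h' : ∀ k, f (i.succAbove k) = g (i.succAbove k) := fun k => congrFun hfg k
    rw [Fin.sum_univ_succAbove _ i] at hf hg
    simp only [h'] at hf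
    ext k
    rcases Fin.eq_self_or_eq_succAbove i k with rfl | ⟨k, rfl⟩
    · simp only; omega
    · exact h' k
  have hs := summable_sum (s := Finset.univ) (fun i _ => hi i)
  have : Summable ((fun f : Fin (p + 1) → ℤ => ∏ i, wgt 1 (f i)) ∘
      (Subtype.val : {f : Fin (p + 1) → ℤ | ∑ i, f i = j} → _)) := by
    refine Summable.of_nonneg_of_le (fun f => ?_) (fun f => ?_) hs
    · exact Finset.prod_nonneg fun j _ => wgt_nonneg zero_le_one _
    · exact prod_bound p f.1
  rw [summable_subtype_iff_indicator] at this
  refine this.congr fun f => ?_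
  simp [Set.indicator_apply]

lemma T_eq_U (n : ℕ) (j : ℤ) : T n j = U 1 n j := by
  unfold T U
  have := tsum_subtype {f : Fin n → ℤ | (∀ i, f i ≠ 0) ∧ ∑ i, f i = j}
    (fun f => ∏ i, (1 : ℝ) / |(f i : ℝ)|)
  refine this.trans (tsum_congr fun f => ?_)
  rw [Set.indicator_apply]
  by_cases h0 : ∀ i, f i ≠ 0
  · simp [h0, wgt]
  · push Not at h0
    obtain ⟨i, hi⟩ := h0
    have h1 : ∏ i, wgt 1 (f i) = 0 :=
      Finset.prod_eq_zero (Finset.mem_univ i) (by simp [wgt, hi])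
    rw [h1, if_neg, ite_self]
    exact fun h => h.1 i hi

lemma tendsto_U (p : ℕ) (j : ℤ) :
    Tendsto (fun x : ℝ => U (1 - x⁻¹) (p + 1) j) atTop (𝓝 (T (p + 1) j)) := by
  rw [T_eq_U]
  unfold U
  have ht : Tendsto (fun x : ℝ => 1 - x⁻¹) atTop (𝓝 1) := by
    simpa using tendsto_const_nhds.sub tendsto_inv_atTop_zero (a := (1 : ℝ))
  refine tendsto_tsum_of_dominated_convergence (summable_fiber p j) ?_ ?_
  · intro f
    split_ifs
    · refine tendsto_finsetProd _ fun i _ => ?_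
      unfold wgt
      exact (ht.pow _).div_const _
    · exact tendsto_const_nhds
  · filter_upwards [eventually_ge_atTop (1 : ℝ)] with x hx f
    have hx1 : x⁻¹ ≤ 1 := inv_le_one_of_one_le₀ hx
    have hx0 : 0 ≤ x⁻¹ := by positivity
    split_ifs
    · rw [Real.norm_of_nonneg (Finset.prod_nonneg fun i _ => wgt_nonneg (by linarith) _)]
      refine Finset.prod_le_prod (fun i _ => wgt_nonneg (by linarith) _) fun i _ => ?_
      unfold wgt
      gcongr
      linarith
    · simp

/-- `k * wgt r k`, i.e. `sgn k * r ^ |k|`. -/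
noncomputable def sg (r : ℝ) (k : ℤ) : ℝ := k * wgt r k

lemma sg_pos (r : ℝ) {k : ℤ} (hk : 0 < k) : sg r k = r ^ k.natAbs := by
  have : (0 : ℝ) < k := by exact_mod_cast hk
  unfold sg wgt
  rw [abs_of_pos this]
  field_simp

lemma sg_neg (r : ℝ) (k : ℤ) : sg r (-k) = - sg r k := by
  simp [sg, wgt_neg]

lemma sg_abs_le {r : ℝ} (hr : 0 ≤ r) (k : ℤ) : |sg r k| ≤ r ^ k.natAbs := by
  rcases lt_trichotomy k 0 with h | h | h
  · have := sg_pos r (k := -k) (by omega)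
    rw [sg_neg, Int.natAbs_neg] at this
    rw [← abs_neg, this, abs_of_nonneg (by positivity)]
  · subst h; simp [sg]
  · rw [sg_pos r h, abs_of_nonneg (by positivity)]

lemma summable_pow_natAbs {r : ℝ} (hr : 0 ≤ r) (hr1 : r < 1) :
    Summable (fun k : ℤ => r ^ k.natAbs) := by
  have h := summable_geometric_of_lt_one hr hr1
  refine Summable.of_nat_of_neg ?_ ?_ <;> simpa using h

noncomputable def cc (α : ℕ) (s : ℤ) : ℝ :=
  2 * ∑ j ∈ Finset.range (α + 1), (if s = (j : ℤ) then 1 else 0)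
    - ((if s = 0 then 1 else 0) + (if s = (α : ℤ) then 1 else 0))

lemma cc_eq (α : ℕ) (s : ℤ) : cc α s = 2 * (if 0 ≤ s ∧ s ≤ α then 1 else 0)
    - ((if s = 0 then 1 else 0) + (if s = (α : ℤ) then 1 else 0)) := by
  unfold cc
  congr 2
  by_cases h : 0 ≤ s ∧ s ≤ α
  · rw [if_pos h]
    obtain ⟨a, rfl⟩ := Int.eq_ofNat_of_zero_le h.1
    rw [Finset.sum_eq_single a]
    · simp
    · intro b _ hb; rw [if_neg]; exact_mod_cast hb.symm
    · intro ha; exfalso; apply ha; simp; omega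
  · rw [if_neg h]
    refine Finset.sum_eq_zero fun j hj => ?_
    rw [if_neg]
    simp at hj; omega

lemma kernel_bound {r : ℝ} (hr : 0 ≤ r) (hr1 : r ≤ 1) {α : ℕ} (hα : 0 < α) (s : ℤ) :
    |(sg r (α - s) + sg r (α + s)) - (cc α s + cc α (-s))| ≤ 2 * (1 - r ^ (2 * α)) := by
  wlog hs : 0 ≤ s generalizing s
  · have := this (-s) (by omega)
    rw [neg_neg, sub_neg_eq_add, ← sub_eq_add_neg] at this
    rwa [add_comm (sg r _), add_comm (cc α s)]
  have hle : ∀ n, r ^ n ≤ 1 := fun n => pow_le_one₀ hr hr1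
  have hp : ∀ n, 0 ≤ r ^ n := fun n => pow_nonneg hr n
  have hmono : ∀ n, n ≤ 2 * α → r ^ (2 * α) ≤ r ^ n := fun n hn =>
    pow_le_pow_of_le_one hr hr1 hn
  rw [cc_eq, cc_eq, sg_pos r (k := α + s) (by omega)]
  obtain ⟨a, rfl⟩ := Int.eq_ofNat_of_zero_le hs
  have e1 : ((α : ℤ) + a).natAbs = α + a := by omega
  rw [e1]
  rcases lt_trichotomy a α with h | h | h
  · rw [sg_pos r (k := α - a) (by omega)]
    have e2 : ((α : ℤ) - a).natAbs = α - a := by omega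
    rw [e2]
    have hc : (2 * (if 0 ≤ (a : ℤ) ∧ (a : ℤ) ≤ α then (1 : ℝ) else 0)
    - ((if (a : ℤ) = 0 then 1 else 0) + (if (a : ℤ) = (α : ℤ) then 1 else 0)) +
      (2 * (if 0 ≤ -(a : ℤ) ∧ -(a : ℤ) ≤ α then 1 else 0)
    - ((if -(a : ℤ) = 0 then 1 else 0) + (if -(a : ℤ) = (α : ℤ) then 1 else 0)))) = 2 := by
      rcases Nat.eq_zero_or_pos a with rfl | ha
      · have : (0 : ℤ) ≠ α := by omega
        simp [this]; norm_num
      · rw [if_pos (by omega), if_neg (by omega), if_neg (by omega), if_neg (by omega),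
          if_neg (by omega), if_neg (by omega)]
        norm_num
    rw [hc, abs_le]
    have := hmono (α + a) (by omega)
    have := hmono (α - a) (by omega)
    have := hle (α + a)
    have := hle (α - a)
    constructor <;> linarith [hle (2 * α)]
  · subst h
    rw [if_pos (by omega), if_neg (by omega), if_pos (by omega), if_neg (by omega),
          if_neg (by omega), if_neg (by omega)]
    have : sg r ((a : ℤ) - a) = 0 := by simp [sg]
    rw [this, abs_le, ← two_mul]
    constructor <;> linarith [hle (2 * a)]
  · rw [if_neg (by omega), if_neg (by omega), if_neg (by omega), if_neg (by omega),
          if_neg (by omega), if_neg (by omega)]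
    have e3 : (α : ℤ) - a = -((a - α : ℕ) : ℤ) := by omega
    rw [e3, sg_neg, sg_pos r (by omega), Int.natAbs_natCast]
    have e4 : α + a = (a - α) + 2 * α := by omega
    rw [e4, pow_add]
    have h1 := hle (a - α)
    have h2 := hp (a - α)
    have h3 := hle (2 * α)
    rw [abs_le]
    constructor <;> nlinarith

lemma sum_index {r : ℝ} (hr : 0 ≤ r) (hr1 : r < 1) (n : ℕ) (α : ℤ) (i : Fin (n + 1)) :
    HasSum (fun f : Fin (n + 1) → ℤ => if ∑ i, f i = α then (f i : ℝ) * ∏ i, wgt r (f i) else 0)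
      (∑' g : Fin n → ℤ, sg r (α - ∑ i, g i) * ∏ i, wgt r (g i)) := by
  have hP := (hasSum_pi (wgt_nonneg hr) (hasSum_wgt hr hr1) n).summable
  have hP0 : (0 : (Fin n → ℤ) → ℝ) ≤ fun f : Fin n → ℤ => ∏ i, wgt r (f i) :=
    fun f => Finset.prod_nonneg fun i _ => wgt_nonneg hr (f i)
  have hr0 : (0 : ℤ → ℝ) ≤ fun k : ℤ => r ^ k.natAbs := fun k => pow_nonneg hr _
  have hS := Summable.mul_of_nonneg hP (summable_pow_natAbs hr hr1) hP0 hr0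
  have hS2 : Summable (fun x : (Fin n → ℤ) × ℤ =>
      if x.2 + ∑ i, x.1 i = α then sg r x.2 * ∏ i, wgt r (x.1 i) else 0) := by
    refine Summable.of_norm_bounded hS fun x => ?_
    have h0 : 0 ≤ ∏ i, wgt r (x.1 i) := hP0 x.1
    split_ifs
    · rw [norm_mul, Real.norm_eq_abs, Real.norm_of_nonneg h0, mul_comm]
      exact mul_le_mul_of_nonneg_left (sg_abs_le hr _) h0
    · simpa using mul_nonneg h0 (hr0 x.2)
  rw [← ((Equiv.prodComm _ _).trans (Fin.insertNthEquiv (fun _ => ℤ) i)).hasSum_iff]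
  have h := hS2.hasSum
  rw [hS2.tsum_prod] at h
  convert h using 1
  · ext x
    simp [Fin.sum_univ_succAbove _ i, Fin.prod_univ_succAbove _ i, sg, mul_assoc]
  · refine tsum_congr fun g => ?_
    rw [tsum_eq_single (α - ∑ i, g i)]
    · simp
    · intro k hk
      rw [if_neg]
      simp only
      omega

lemma recursion_r {r : ℝ} (hr : 0 ≤ r) (hr1 : r < 1) (n : ℕ) (α : ℤ) :
    α * U r (n + 1) α =
      (n + 1) * ∑' g : Fin n → ℤ, sg r (α - ∑ i, g i) * ∏ i, wgt r (g i) := by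
  have h := hasSum_sum (s := Finset.univ) (fun i _ => sum_index hr hr1 n α i)
  simp only [Finset.sum_const, Finset.card_univ, Fintype.card_fin, nsmul_eq_mul] at h
  push_cast at h
  rw [← h.tsum_eq, U, ← tsum_mul_left]
  refine tsum_congr fun f => ?_
  by_cases hf : ∑ i, f i = α
  · simp only [hf, if_true]
    rw [← Finset.sum_mul, ← hf]
    push_cast
    rfl
  · simp [hf]

lemma summable_bdd {r : ℝ} (hr : 0 ≤ r) (hr1 : r < 1) (n : ℕ) (h : ℤ → ℝ) (C : ℝ)
    (hC : ∀ k, |h k| ≤ C) :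
    Summable (fun g : Fin n → ℤ => h (∑ i, g i) * ∏ i, wgt r (g i)) := by
  have hP := (hasSum_pi (wgt_nonneg hr) (hasSum_wgt hr hr1) n).summable
  refine Summable.of_norm_bounded (hP.mul_left C) fun g => ?_
  have h0 : 0 ≤ ∏ i, wgt r (g i) := Finset.prod_nonneg fun i _ => wgt_nonneg hr (g i)
  rw [norm_mul, Real.norm_eq_abs, Real.norm_of_nonneg h0]
  exact mul_le_mul_of_nonneg_right (hC _) h0

lemma tsum_symm (r : ℝ) (n : ℕ) (h : ℤ → ℝ) :
    ∑' g : Fin n → ℤ, h (-∑ i, g i) * ∏ i, wgt r (g i) =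
      ∑' g : Fin n → ℤ, h (∑ i, g i) * ∏ i, wgt r (g i) := by
  rw [← (Equiv.neg (Fin n → ℤ)).tsum_eq (fun g => h (∑ i, g i) * ∏ i, wgt r (g i))]
  refine tsum_congr fun g => ?_
  simp [wgt_neg]

lemma tsum_cc {r : ℝ} (hr : 0 ≤ r) (hr1 : r < 1) (n : ℕ) (α : ℕ) :
    HasSum (fun g : Fin n → ℤ => cc α (∑ i, g i) * ∏ i, wgt r (g i))
      (2 * ∑ j ∈ Finset.range (α + 1), U r n j - (U r n 0 + U r n α)) := by
  have hU : ∀ j : ℤ, HasSum (fun g : Fin n → ℤ =>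
      (if ∑ i, g i = j then (1 : ℝ) else 0) * ∏ i, wgt r (g i)) (U r n j) := by
    intro j
    have h := (summable_bdd hr hr1 n (fun k => if k = j then (1 : ℝ) else 0) 1
      (fun k => by split_ifs <;> simp)).hasSum
    convert h using 1
    unfold U
    refine tsum_congr fun g => ?_
    split_ifs <;> simp
  have h := ((hasSum_sum (s := Finset.range (α + 1)) (fun j _ => hU (j : ℤ))).mul_left 2).sub
    ((hU 0).add (hU α))
  have e : (fun g : Fin n → ℤ => cc α (∑ i, g i) * ∏ i, wgt r (g i)) = fun g : Fin n → ℤ =>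
      2 * (∑ j ∈ Finset.range (α + 1),
        (if ∑ i, g i = (j : ℤ) then (1 : ℝ) else 0) * ∏ i, wgt r (g i)) -
      ((if ∑ i, g i = 0 then (1 : ℝ) else 0) * ∏ i, wgt r (g i) +
        (if ∑ i, g i = (α : ℤ) then (1 : ℝ) else 0) * ∏ i, wgt r (g i)) := by
    funext g
    unfold cc
    rw [sub_mul, add_mul, mul_assoc, Finset.sum_mul]
  rw [e]
  exact h

lemma approx {r : ℝ} (hr : 0 ≤ r) (hr1 : r < 1) (n : ℕ) {α : ℕ} (hα : 0 < α) :
    |∑' g : Fin n → ℤ, sg r (α - ∑ i, g i) * ∏ i, wgt r (g i)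
      - (2 * ∑ j ∈ Finset.range (α + 1), U r n j - (U r n 0 + U r n α))|
      ≤ (1 - r ^ (2 * α)) * (-2 * Real.log (1 - r)) ^ n := by
  have hP := hasSum_pi (wgt_nonneg hr) (hasSum_wgt hr hr1) n
  have hsg : ∀ k, |sg r k| ≤ 1 := fun k => (sg_abs_le hr k).trans (pow_le_one₀ hr hr1.le)
  have a1 := summable_bdd hr hr1 n (fun k => sg r (α - k)) 1 (fun k => hsg _)
  have a2 := summable_bdd hr hr1 n (fun k => sg r (α - -k)) 1 (fun k => hsg _)
  have b1 := tsum_cc hr hr1 n α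
  have hcc : ∀ k, |cc α k| ≤ 4 := by
    intro k
    rw [cc_eq, abs_le]
    split_ifs <;> norm_num
  have b2 := summable_bdd hr hr1 n (fun k => cc α (-k)) 4 (fun k => hcc _)
  have e1 := tsum_symm r n (fun k => sg r (α - k))
  have e2 := tsum_symm r n (fun k => cc α k)
  rw [b1.tsum_eq] at e2
  have A2 := a2.hasSum
  rw [e1] at A2
  have B2 := b2.hasSum
  rw [e2] at B2
  have H := (a1.hasSum.add A2).sub (b1.add B2)
  have H2 := hP.mul_left (2 * (1 - r ^ (2 * α)))
  have hb : ∀ g : Fin n → ℤ, |(sg r (α - ∑ i, g i) * ∏ i, wgt r (g i) +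
      sg r (α - -∑ i, g i) * ∏ i, wgt r (g i)) - (cc α (∑ i, g i) * ∏ i, wgt r (g i) +
      cc α (-∑ i, g i) * ∏ i, wgt r (g i))| ≤ 2 * (1 - r ^ (2 * α)) * ∏ i, wgt r (g i) := by
    intro g
    have h0 : 0 ≤ ∏ i, wgt r (g i) := Finset.prod_nonneg fun i _ => wgt_nonneg hr (g i)
    rw [← add_mul, ← add_mul, ← sub_mul, abs_mul, abs_of_nonneg h0, sub_neg_eq_add]
    exact mul_le_mul_of_nonneg_right (kernel_bound hr hr1.le hα _) h0
  have u1 := hasSum_le (fun g => (abs_le.1 (hb g)).2) H H2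
  have u2 := hasSum_le (fun g => (abs_le.1 (hb g)).1) H2.neg H
  rw [abs_le]
  constructor <;> linarith

lemma err_tendsto (n α : ℕ) :
    Tendsto (fun x : ℝ => (1 - (1 - x⁻¹) ^ (2 * α)) * (-2 * Real.log (1 - (1 - x⁻¹))) ^ n)
      atTop (𝓝 0) := by
  have h := (Real.tendsto_pow_log_div_mul_add_atTop 1 0 n one_ne_zero).const_mul
    ((2 * α : ℕ) * (2 : ℝ) ^ n)
  rw [mul_zero] at h
  refine tendsto_of_tendsto_of_tendsto_of_le_of_le' tendsto_const_nhds h ?_ ?_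
  all_goals
    filter_upwards [eventually_ge_atTop (1 : ℝ)] with x hx
    have hx1 : x⁻¹ ≤ 1 := inv_le_one_of_one_le₀ hx
    have hx0 : 0 ≤ x⁻¹ := by positivity
    have hl : 0 ≤ Real.log x := Real.log_nonneg hx
    have e : -2 * Real.log (1 - (1 - x⁻¹)) = 2 * Real.log x := by
      rw [sub_sub_cancel, Real.log_inv]; ring
    rw [e]
  · have : (1 - x⁻¹) ^ (2 * α) ≤ 1 := pow_le_one₀ (by linarith) (by linarith)
    exact mul_nonneg (by linarith) (by positivity)
  · have hb := one_add_mul_le_pow (a := -x⁻¹) (by linarith) (2 * α)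
    rw [← sub_eq_add_neg] at hb
    calc _ ≤ ((2 * α : ℕ) * x⁻¹) * (2 * Real.log x) ^ n := by
          apply mul_le_mul_of_nonneg_right _ (by positivity)
          linarith
      _ = _ := by rw [mul_pow]; simp only [one_mul, add_zero]; ring

theorem T_recursion (m : ℕ) (hm : 1 < m) (α : ℕ) (hα : 0 < α) :
    T m α = (2 * m / α) * ∑ j ∈ Finset.range (α + 1), T (m - 1) j
      - ((m : ℝ) / α) * (T (m - 1) 0 + T (m - 1) α) := by
  obtain ⟨p, rfl⟩ : ∃ p, m = p + 1 + 1 := ⟨m - 2, by omega⟩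
  rw [Nat.add_sub_cancel]
  have hα' : (α : ℝ) ≠ 0 := by positivity
  have t1 := (tendsto_U (p + 1) α).const_mul ((α : ℝ) / ((p + 1 : ℕ) + 1))
  have t2 := ((tendsto_finsetSum (Finset.range (α + 1))
    (fun j _ => tendsto_U p (j : ℤ))).const_mul 2).sub ((tendsto_U p 0).add (tendsto_U p α))
  have t3 : Tendsto (fun x : ℝ => ((α : ℝ) / ((p + 1 : ℕ) + 1)) * U (1 - x⁻¹) (p + 1 + 1) α -
      (2 * ∑ j ∈ Finset.range (α + 1), U (1 - x⁻¹) (p + 1) j -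
        (U (1 - x⁻¹) (p + 1) 0 + U (1 - x⁻¹) (p + 1) α))) atTop (𝓝 0) := by
    refine squeeze_zero_norm' ?_ (err_tendsto (p + 1) α)
    filter_upwards [eventually_ge_atTop (1 : ℝ)] with x hx
    have hx1 : x⁻¹ ≤ 1 := inv_le_one_of_one_le₀ hx
    have hx0 : 0 < x⁻¹ := by positivity
    have hr : 0 ≤ 1 - x⁻¹ := by linarith
    have hr1 : 1 - x⁻¹ < 1 := by linarith
    have h1 := recursion_r hr hr1 (p + 1) α
    have h2 := approx hr hr1 (p + 1) hα
    have h3 : ((α : ℝ) / ((p + 1 : ℕ) + 1)) * U (1 - x⁻¹) (p + 1 + 1) α =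
        ∑' g : Fin (p + 1) → ℤ, sg (1 - x⁻¹) (α - ∑ i, g i) * ∏ i, wgt (1 - x⁻¹) (g i) := by
      rw [div_mul_eq_mul_div, div_eq_iff (by positivity), mul_comm (tsum _)]
      exact_mod_cast h1
    rw [h3, Real.norm_eq_abs]
    exact h2
  have key := tendsto_nhds_unique t3 (t1.sub t2)
  have hp : ((p + 1 : ℕ) : ℝ) + 1 ≠ 0 := by positivity
  push_cast at key hp ⊢
  field_simp at key ⊢
  linarith
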